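/- For every δ > 0 there exists n₀ ∈ ℕ such that for all n > n₀: every even permutation h of Z₂ⁿ can be realized by a reversible circuit with n inputs (no additional inputs) of gates from Ωₙ² whose quantum weight is at most (16·W_C + 32·W_T + δ)·n·2ⁿ/log₂ n; in particular the Shannon quantum weight function satisfies W(n,0) ≤ (16·W_C + 32·W_T + δ)·n·2ⁿ/log₂ n. -/

import Mathlib

namespace RevCirc

/-- A reversible gate on `n` wires: a target coordinate together with a set of
at most two control coordinates not containing the target.  With no controls it
is a NOT gate, with one control a CNOT gate and with two controls a 2-CNOT
(Toffoli) gate. -/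
abbrev Gate (n : ℕ) : Type :=
  {p : Fin n × Finset (Fin n) // p.2.card ≤ 2 ∧ p.1 ∉ p.2}

def Gate.target {n : ℕ} (g : Gate n) : Fin n := g.1.1

def Gate.controls {n : ℕ} (g : Gate n) : Finset (Fin n) := g.1.2

/-- The transformation of `ℤ₂ⁿ` defined by a gate: the target coordinate is
XOR-ed with the conjunction of the control coordinates. -/
def Gate.apply {n : ℕ} (g : Gate n) (x : Fin n → Bool) : Fin n → Bool :=
  fun i => if i = g.target then xor (x i) (decide (∀ j ∈ g.controls, x j = true)) else x i

/-- The transformation defined by a circuit (a list of gates, applied left to right). -/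
def evalCircuit {n : ℕ} (c : List (Gate n)) (x : Fin n → Bool) : Fin n → Bool :=
  c.foldl (fun y g => g.apply y) x

/-- A circuit realizes a permutation `h` of `ℤ₂ⁿ` (without additional inputs) if the
composition of its gates equals `h`. -/
def realizes {n : ℕ} (c : List (Gate n)) (h : Equiv.Perm (Fin n → Bool)) : Prop :=
  ∀ x, evalCircuit c x = h x

/-- The expanding function `ℤ₂ⁿ → ℤ₂^{n+q}` padding with zeros. -/
def expand (n q : ℕ) (x : Fin n → Bool) : Fin (n + q) → Bool :=
  fun i => if h : (i : ℕ) < n then x ⟨i, h⟩ else false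

/-- A circuit with `n+q` inputs implements `f : ℤ₂ⁿ → ℤ₂ⁿ` using `q` additional
inputs if for some permutation `π` of the wires, the coordinates `π(1),…,π(n)` of the
output on the zero-padded input give `f`. -/
def implements (n q : ℕ) (c : List (Gate (n + q)))
    (f : (Fin n → Bool) → (Fin n → Bool)) : Prop :=
  ∃ π : Equiv.Perm (Fin (n + q)), ∀ x : Fin n → Bool, ∀ i : Fin n,
    evalCircuit c (expand n q x) (π (Fin.castLE (Nat.le_add_right n q) i)) = f x i

/-- `F(n,q)`: the set of transformations `ℤ₂ⁿ → ℤ₂ⁿ` implementable by reversible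
circuits with `n+q` inputs. -/
def FSet (n q : ℕ) : Set ((Fin n → Bool) → (Fin n → Bool)) :=
  {f | ∃ c : List (Gate (n + q)), implements n q c f}

/-- The set of wires touched by a gate: its target together with its controls. -/
def Gate.support {n : ℕ} (g : Gate n) : Finset (Fin n) := insert g.target g.controls

/-- A circuit has depth 1 if the supports of its gates are pairwise disjoint. -/
def DepthOne {n : ℕ} (c : List (Gate n)) : Prop :=
  c.Pairwise fun g₁ g₂ => Disjoint g₁.support g₂.support

/-- The depth of a circuit: the minimal number of consecutive depth-1 sub-circuits
into which it can be divided. -/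
noncomputable def depth {n : ℕ} (c : List (Gate n)) : ℕ :=
  sInf {d | ∃ parts : List (List (Gate n)),
    parts.flatten = c ∧ (∀ p ∈ parts, DepthOne p) ∧ parts.length = d}

/-- The quantum weight of a circuit: each NOT and CNOT gate weighs `WC`, each
2-CNOT gate weighs `WT`. -/
def weight {n : ℕ} (WC WT : ℝ) (c : List (Gate n)) : ℝ :=
  (c.map fun g => if g.controls.card = 2 then WT else WC).sum

/-- `L(f,q)`: minimal gate complexity of a circuit implementing `f` with `q`
additional inputs. -/
noncomputable def Lmin (n q : ℕ) (f : (Fin n → Bool) → (Fin n → Bool)) : ℕ :=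
  sInf {l | ∃ c : List (Gate (n + q)), implements n q c f ∧ c.length = l}

/-- The Shannon gate complexity function `L(n,q)`. -/
noncomputable def ShannonL (n q : ℕ) : ℕ := sSup (Lmin n q '' FSet n q)

/-- `D(f,q)`: minimal depth of a circuit implementing `f` with `q` additional inputs. -/
noncomputable def Dmin (n q : ℕ) (f : (Fin n → Bool) → (Fin n → Bool)) : ℕ :=
  sInf {d | ∃ c : List (Gate (n + q)), implements n q c f ∧ depth c = d}

/-- The Shannon depth function `D(n,q)`. -/
noncomputable def ShannonD (n q : ℕ) : ℕ := sSup (Dmin n q '' FSet n q)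

/-- `W(f,q)`: minimal quantum weight of a circuit implementing `f` with `q`
additional inputs. -/
noncomputable def Wmin (WC WT : ℝ) (n q : ℕ) (f : (Fin n → Bool) → (Fin n → Bool)) : ℝ :=
  sInf {w | ∃ c : List (Gate (n + q)), implements n q c f ∧ weight WC WT c = w}

/-- The Shannon quantum weight function `W(n,q)`. -/
noncomputable def ShannonW (WC WT : ℝ) (n q : ℕ) : ℝ := sSup (Wmin WC WT n q '' FSet n q)

/-- A permutation is a product of `K` pairwise disjoint (independent) transpositions:
there are `2K` pairwise distinct points `x i, y i` with `g = (x 1, y 1)∘⋯∘(x K, y K)`. -/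
def IsProdOfDisjointTranspositions {X : Type*} [DecidableEq X] (K : ℕ)
    (g : Equiv.Perm X) : Prop :=
  ∃ x y : Fin K → X,
    Function.Injective (Sum.elim x y) ∧
    g = ((List.finRange K).map fun i => Equiv.swap (x i) (y i)).prod

end RevCirc


namespace RevCirc

/-- `f` is computed by a circuit of weight at most `w`. -/
def CostF {n : ℕ} (WC WT : ℝ) (f : (Fin n → Bool) → (Fin n → Bool)) (w : ℝ) : Prop :=
  ∃ c : List (Gate n), (∀ x, evalCircuit c x = f x) ∧ weight WC WT c ≤ w

theorem dec_congr {P Q : Prop} [Decidable P] [Decidable Q] (h : P ↔ Q) : decide P = decide Q :=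
  decide_eq_decide.2 h

theorem gate_apply_apply {n : ℕ} (g : Gate n) (x : Fin n → Bool) : g.apply (g.apply x) = x := by
  funext i
  have hg : g.target ∉ g.controls := g.2.2
  have key : (∀ j ∈ g.controls, g.apply x j = true) ↔ (∀ j ∈ g.controls, x j = true) := by
    refine forall₂_congr fun j hj => ?_
    have : j ≠ g.target := fun h => hg (h ▸ hj)
    simp [Gate.apply, this]
  by_cases hi : i = g.target
  · have h1 : g.apply (g.apply x) i = xor (g.apply x i) (decide (∀ j ∈ g.controls, g.apply x j = true)) := by
      rw [Gate.apply, if_pos hi]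
    have h2 : g.apply x i = xor (x i) (decide (∀ j ∈ g.controls, x j = true)) := by
      rw [Gate.apply, if_pos hi]
    have hk := dec_congr key
    rw [h1, h2, hk]
    simp
  · simp [Gate.apply, hi]

theorem evalCircuit_append {n : ℕ} (c d : List (Gate n)) (x : Fin n → Bool) :
    evalCircuit (c ++ d) x = evalCircuit d (evalCircuit c x) := by
  simp [evalCircuit]

theorem evalCircuit_cons {n : ℕ} (g : Gate n) (d : List (Gate n)) (x : Fin n → Bool) :
    evalCircuit (g :: d) x = evalCircuit d (g.apply x) := by
  simp [evalCircuit]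

theorem evalCircuit_reverse {n : ℕ} (c : List (Gate n)) (x : Fin n → Bool) :
    evalCircuit c.reverse (evalCircuit c x) = x := by
  induction c generalizing x with
  | nil => rfl
  | cons g c ih =>
    rw [List.reverse_cons, evalCircuit_append, evalCircuit_cons g c x, ih]
    simp [evalCircuit, gate_apply_apply]

theorem weight_append {n : ℕ} (WC WT : ℝ) (c d : List (Gate n)) :
    weight WC WT (c ++ d) = weight WC WT c + weight WC WT d := by
  simp [weight]

theorem weight_reverse {n : ℕ} (WC WT : ℝ) (c : List (Gate n)) :
    weight WC WT c.reverse = weight WC WT c := by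
  simp [weight, List.sum_reverse]

theorem weight_nonneg {n : ℕ} {WC WT : ℝ} (hC : 0 < WC) (hT : 0 < WT) (c : List (Gate n)) :
    0 ≤ weight WC WT c := by
  apply List.sum_nonneg
  intro x hx
  obtain ⟨g, -, rfl⟩ := List.mem_map.1 hx
  split_ifs <;> linarith

/-- The permutation of a circuit. -/
def circPerm {n : ℕ} (c : List (Gate n)) : Equiv.Perm (Fin n → Bool) where
  toFun := evalCircuit c
  invFun := evalCircuit c.reverse
  left_inv := evalCircuit_reverse c
  right_inv x := by
    have := evalCircuit_reverse c.reverse x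
    rwa [List.reverse_reverse] at this

section
variable {n : ℕ} {WC WT : ℝ}

theorem CostF.mono {f : (Fin n → Bool) → (Fin n → Bool)} {a b : ℝ}
    (h : CostF WC WT f a) (hab : a ≤ b) : CostF WC WT f b := by
  obtain ⟨c, h1, h2⟩ := h
  exact ⟨c, h1, h2.trans hab⟩

theorem CostF.id_zero : CostF WC WT (fun x : Fin n → Bool => x) 0 :=
  ⟨[], fun _ => rfl, by simp [weight]⟩

theorem CostF.comp {f g : (Fin n → Bool) → (Fin n → Bool)} {a b : ℝ}
    (hf : CostF WC WT f a) (hg : CostF WC WT g b) : CostF WC WT (fun x => f (g x)) (a + b) := by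
  obtain ⟨c, h1, h2⟩ := hf
  obtain ⟨d, h3, h4⟩ := hg
  refine ⟨d ++ c, fun x => ?_, ?_⟩
  · rw [evalCircuit_append, h3, h1]
  · rw [weight_append]; linarith

theorem CostF.congr {f g : (Fin n → Bool) → (Fin n → Bool)} {a : ℝ}
    (hf : CostF WC WT f a) (h : ∀ x, f x = g x) : CostF WC WT g a := by
  obtain ⟨c, h1, h2⟩ := hf
  exact ⟨c, fun x => (h1 x).trans (h x), h2⟩

theorem CostF.exists_perm {f : (Fin n → Bool) → (Fin n → Bool)} {a : ℝ}
    (hf : CostF WC WT f a) : ∃ p : Equiv.Perm (Fin n → Bool), (∀ x, p x = f x) ∧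
      CostF WC WT p a ∧ CostF WC WT p.symm a := by
  obtain ⟨c, h1, h2⟩ := hf
  refine ⟨circPerm c, h1, ⟨c, fun _ => rfl, h2⟩, ⟨c.reverse, fun _ => rfl, ?_⟩⟩
  rwa [weight_reverse]

theorem CostF.injective {f : (Fin n → Bool) → (Fin n → Bool)} {a : ℝ}
    (hf : CostF WC WT f a) : Function.Injective f := by
  obtain ⟨p, hp, -⟩ := hf.exists_perm
  intro x y h
  rw [← hp, ← hp] at h
  exact p.injective h

/-- A layer: every wire `j` of `J` is XOR-ed with the conjunction of the wires `S j`. -/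
def layer (J : Finset (Fin n)) (S : Fin n → Finset (Fin n)) (x : Fin n → Bool) : Fin n → Bool :=
  fun j => if j ∈ J then xor (x j) (decide (∀ i ∈ S j, x i = true)) else x j

/-- Multi-controlled NOT. -/
def mct (C : Finset (Fin n)) (t : Fin n) (x : Fin n → Bool) : Fin n → Bool :=
  fun j => if j = t then xor (x j) (decide (∀ i ∈ C, x i = true)) else x j

theorem costF_gate {C : Finset (Fin n)} {t : Fin n} (h : C.card ≤ 2) (ht : t ∉ C) :
    CostF WC WT (mct C t) (if C.card = 2 then WT else WC) := by
  refine ⟨[⟨(t, C), h, ht⟩], fun x => ?_, ?_⟩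
  · rfl
  · simp only [weight, Gate.controls, List.map_cons, List.map_nil, List.sum_cons, List.sum_nil, add_zero]
    exact le_rfl

theorem costF_gate' (hC : 0 < WC) (hT : 0 < WT) {C : Finset (Fin n)} {t : Fin n}
    (h : C.card ≤ 2) (ht : t ∉ C) :
    CostF WC WT (mct C t) (WC + WT) := by
  refine (costF_gate h ht).mono ?_
  split_ifs <;> linarith

theorem layer_of_mem {J : Finset (Fin n)} {S : Fin n → Finset (Fin n)} {x : Fin n → Bool}
    {j : Fin n} (h : j ∈ J) : layer J S x j = xor (x j) (decide (∀ i ∈ S j, x i = true)) := by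
  simp [layer, h]

theorem layer_of_notMem {J : Finset (Fin n)} {S : Fin n → Finset (Fin n)} {x : Fin n → Bool}
    {j : Fin n} (h : j ∉ J) : layer J S x j = x j := by
  simp [layer, h]

theorem mct_self {C : Finset (Fin n)} {t : Fin n} {x : Fin n → Bool} :
    mct C t x t = xor (x t) (decide (∀ i ∈ C, x i = true)) := by
  simp [mct]

theorem mct_ne {C : Finset (Fin n)} {t j : Fin n} {x : Fin n → Bool} (h : j ≠ t) :
    mct C t x j = x j := by
  simp [mct, h]

theorem costF_layer (J : Finset (Fin n)) (S : Fin n → Finset (Fin n))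
    (h1 : ∀ j ∈ J, (S j).card ≤ 1) (h2 : ∀ j ∈ J, ∀ i ∈ S j, i ∉ J) :
    CostF WC WT (layer J S) (J.card * WC) := by
  induction J using Finset.induction_on with
  | empty =>
    refine (CostF.id_zero (WC := WC) (WT := WT)).mono (by simp) |>.congr fun x => ?_
    funext j; simp [layer]
  | insert a J ha ih =>
    have ih' := ih (fun j hj => h1 j (Finset.mem_insert_of_mem hj))
      (fun j hj i hi => fun h => h2 j (Finset.mem_insert_of_mem hj) i hi (Finset.mem_insert_of_mem h))
    have hc := h1 a (Finset.mem_insert_self _ _)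
    have hS : ∀ i ∈ S a, i ∉ insert a J := h2 a (Finset.mem_insert_self _ _)
    have hg : CostF WC WT (mct (S a) a) WC := by
      have := costF_gate (WC := WC) (WT := WT) (C := S a) (t := a) (by omega)
        (fun h => hS a h (Finset.mem_insert_self _ _))
      rwa [if_neg (by omega)] at this
    refine ((hg.comp ih').mono ?_).congr fun x => ?_
    · rw [Finset.card_insert_of_notMem ha]; push_cast; linarith
    · funext j
      by_cases hj : j = a
      · subst hj
        rw [mct_self, layer_of_notMem ha, layer_of_mem (Finset.mem_insert_self _ _)]
        congr 1
        rw [decide_eq_decide]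
        refine forall₂_congr fun i hi => ?_
        rw [layer_of_notMem (fun h => hS i hi (Finset.mem_insert_of_mem h))]
      · rw [mct_ne hj]
        by_cases hjJ : j ∈ J
        · rw [layer_of_mem hjJ, layer_of_mem (Finset.mem_insert_of_mem hjJ)]
        · rw [layer_of_notMem hjJ, layer_of_notMem (by simp [hj, hjJ])]

theorem layer_layer (J : Finset (Fin n)) (S : Fin n → Finset (Fin n))
    (h2 : ∀ j ∈ J, ∀ i ∈ S j, i ∉ J) (x : Fin n → Bool) : layer J S (layer J S x) = x := by
  funext j
  by_cases hj : j ∈ J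
  · rw [layer_of_mem hj, layer_of_mem hj]
    have : (∀ i ∈ S j, layer J S x i = true) ↔ (∀ i ∈ S j, x i = true) :=
      forall₂_congr fun i hi => by rw [layer_of_notMem (h2 j hj i hi)]
    have hk := dec_congr this
    rw [hk]; simp
  · rw [layer_of_notMem hj, layer_of_notMem hj]

theorem bool_aux1 (w c v : Bool) (P : Prop) [Decidable P] :
    xor (xor w (decide (c = true ∧ v = true))) (decide (c = true ∧ xor v (decide P) = true)) =
      xor w (decide (c = true ∧ P)) := by
  by_cases hP : P <;> cases w <;> cases c <;> cases v <;> simp [hP]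

theorem bool_aux2 (t d : Bool) (P Q : Prop) [Decidable P] [Decidable Q] :
    xor (xor t (decide (xor d (decide P) = true ∧ Q))) 
      (decide (xor (xor d (decide P)) (decide P) = true ∧ Q)) = xor t (decide (P ∧ Q)) := by
  by_cases hP : P <;> by_cases hQ : Q <;> cases t <;> cases d <;> simp [hP, hQ]

/-- The ladder with garbage. -/
theorem exists_ladder (hC : 0 < WC) (hT : 0 < WT) (c w : ℕ → Fin n) (k : ℕ)
    (hw : ∀ i ≤ k, ∀ j ≤ k, w i = w j → i = j) (hcw : ∀ i ≤ k, ∀ j ≤ k, c i ≠ w j) :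
    ∃ f : (Fin n → Bool) → (Fin n → Bool), CostF WC WT f ((2 * k + 1) * (WC + WT)) ∧
      (∀ x, ∀ j ≤ k, f x (w j) = xor (x (w j)) (decide (∀ i ≤ j, x (c i) = true))) ∧
      (∀ x i, (∀ j ≤ k, i ≠ w j) → f x i = x i) := by
  induction k with
  | zero =>
    refine ⟨mct {c 0} (w 0), (costF_gate' hC hT (by simp) ?_).mono (by simp), ?_, ?_⟩
    · simpa using (hcw 0 le_rfl 0 le_rfl).symm
    · intro x j hj
      obtain rfl : j = 0 := by omega
      rw [mct_self]; simp
    · intro x i hi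
      rw [mct_ne (hi 0 le_rfl)]
  | succ k ih =>
    obtain ⟨f, hf, hf1, hf2⟩ := ih (fun i hi j hj => hw i (by omega) j (by omega))
      (fun i hi j hj => hcw i (by omega) j (by omega))
    have hwk : ∀ j ≤ k, w (k+1) ≠ w j := fun j hj h => by
      have := hw _ le_rfl _ (by omega) h; omega
    have hT1 : CostF WC WT (mct {c (k+1), w k} (w (k+1))) (WC + WT) := by
      apply costF_gate' hC hT Finset.card_le_two
      simp only [Finset.mem_insert, Finset.mem_singleton, not_or]
      exact ⟨(hcw _ le_rfl _ le_rfl).symm, hwk k le_rfl⟩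
    refine ⟨_, ((hT1.comp (hf.comp hT1)).mono ?_), ?_, ?_⟩
    · push_cast; linarith
    · intro x j hj
      set y := mct {c (k+1), w k} (w (k+1)) x with hy
      have hyc : ∀ i ≤ k + 1, y (c i) = x (c i) := fun i hi =>
        mct_ne (hcw i hi _ le_rfl)
      have hyw : ∀ i ≤ k, y (w i) = x (w i) := fun i hi => mct_ne (hwk i hi).symm
      by_cases hjk : j = k + 1
      · subst hjk
        rw [mct_self, hf2 y _ hwk, hy, mct_self, ← hy]
        simp only [Finset.mem_insert, Finset.mem_singleton, forall_eq_or_imp, forall_eq]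
        rw [hf1 y k le_rfl, hf2 y (c (k+1)) (fun j hj => hcw _ le_rfl _ (by omega)),
          hyc _ le_rfl, hyw _ le_rfl]
        have h3 : (∀ i ≤ k, y (c i) = true) ↔ (∀ i ≤ k, x (c i) = true) :=
          forall₂_congr fun i hi => by rw [hyc i (by omega)]
        have h4 : (∀ i ≤ k + 1, x (c i) = true) ↔ (x (c (k+1)) = true ∧ ∀ i ≤ k, x (c i) = true) := by
          constructor
          · exact fun h => ⟨h _ le_rfl, fun i hi => h i (by omega)⟩
          · rintro ⟨h, h'⟩ i hi
            rcases Nat.lt_or_ge k i with h5 | h5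
            · obtain rfl : i = k + 1 := by omega
              exact h
            · exact h' i h5
        have h5 := dec_congr h3
        have h6 := dec_congr h4
        rw [h5, h6]
        exact bool_aux1 _ _ _ _
      · have hj' : j ≤ k := by omega
        rw [mct_ne (hwk j hj').symm, hf1 y j hj', hyw j hj']
        congr 1
        rw [decide_eq_decide]
        exact forall₂_congr fun i hi => by rw [hyc i (by omega)]
    · intro x i hi
      rw [mct_ne (hi _ le_rfl), hf2 _ _ (fun j hj => hi j (by omega)), mct_ne (hi _ le_rfl)]

theorem costF_mct_seq (hC : 0 < WC) (hT : 0 < WT) (c w : ℕ → Fin n) (k : ℕ)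
    (hw : ∀ i ≤ k, ∀ j ≤ k, w i = w j → i = j) (hcw : ∀ i ≤ k, ∀ j ≤ k, c i ≠ w j)
    (C : Finset (Fin n)) (hCc : ∀ i, i ∈ C ↔ ∃ j ≤ k, c j = i) :
    CostF WC WT (mct C (w k)) (4 * (k + 1) * (WC + WT)) := by
  have hCC : ∀ x : Fin n → Bool, (∀ i ∈ C, x i = true) ↔ (∀ j ≤ k, x (c j) = true) := by
    intro x
    constructor
    · exact fun h j hj => h _ ((hCc _).2 ⟨j, hj, rfl⟩)
    · intro h i hi
      obtain ⟨j, hj, rfl⟩ := (hCc _).1 hi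
      exact h j hj
  obtain ⟨f, hf, hf1, hf2⟩ := exists_ladder hC hT c w k hw hcw
  cases k with
  | zero =>
    refine (hf.mono ?_).congr fun x => ?_
    · push_cast; nlinarith
    · funext i
      by_cases hi : i = w 0
      · subst hi
        rw [hf1 x 0 le_rfl, mct_self, dec_congr (hCC x)]
      · rw [mct_ne hi, hf2]
        intro j hj
        obtain rfl : j = 0 := by omega
        exact hi
  | succ k =>
    obtain ⟨g, hg, hg1, hg2⟩ := exists_ladder hC hT c w k
      (fun i hi j hj => hw i (by omega) j (by omega)) (fun i hi j hj => hcw i (by omega) j (by omega))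
    have hwk : ∀ j ≤ k, w (k+1) ≠ w j := fun j hj h => by
      have := hw _ le_rfl _ (by omega) h; omega
    refine ((hg.comp hf).mono ?_).congr fun x => ?_
    · push_cast; nlinarith
    · have hfc : ∀ i ≤ k + 1, f x (c i) = x (c i) := fun i hi =>
        hf2 x _ (fun j hj => hcw i hi j hj)
      funext i
      by_cases hi : i = w (k+1)
      · subst hi
        rw [hg2 _ _ hwk, hf1 x _ le_rfl, mct_self, dec_congr (hCC x)]
      · rw [mct_ne hi]
        by_cases hi2 : ∃ j ≤ k, i = w j
        · obtain ⟨j, hj, rfl⟩ := hi2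
          rw [hg1 _ j hj, hf1 x j (by omega)]
          have : (∀ i ≤ j, f x (c i) = true) ↔ (∀ i ≤ j, x (c i) = true) :=
            forall₂_congr fun i hi => by rw [hfc i (by omega)]
          have hk := dec_congr this
          rw [hk]; simp
        · push Not at hi2
          rw [hg2 _ _ hi2, hf2]
          intro j hj
          rcases Nat.lt_or_ge k j with h5 | h5
          · obtain rfl : j = k + 1 := by omega
            exact hi
          · exact hi2 j h5

/-- Multi-controlled NOT with many dirty wires. -/
theorem costF_mct_small (hC : 0 < WC) (hT : 0 < WT) (C : Finset (Fin n)) (t : Fin n)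
    (ht : t ∉ C) (hcard : 2 * C.card ≤ n) :
    CostF WC WT (mct C t) (4 * (C.card + 1) * (WC + WT)) := by
  rcases Nat.eq_zero_or_pos C.card with h0 | hpos
  · refine (costF_gate' hC hT (by omega) ht).mono ?_
    rw [h0]; push_cast; linarith
  obtain ⟨k, hk⟩ : ∃ k, C.card = k + 1 := ⟨C.card - 1, by omega⟩
  have hD : k ≤ ((insert t C)ᶜ : Finset (Fin n)).card := by
    rw [Finset.card_compl, Finset.card_insert_of_notMem ht, Fintype.card_fin]; omega
  obtain ⟨D, hDs, hDc⟩ := Finset.exists_subset_card_eq hD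
  let e := (C.equivFinOfCardEq hk).symm
  let d := (D.equivFinOfCardEq hDc).symm
  let c : ℕ → Fin n := fun j => if h : j < k + 1 then (e ⟨j, h⟩ : Fin n) else t
  let w : ℕ → Fin n := fun j => if h : j < k then (d ⟨j, h⟩ : Fin n) else t
  have hdm : ∀ j (h : j < k), (d ⟨j, h⟩ : Fin n) ≠ t ∧ (d ⟨j, h⟩ : Fin n) ∉ C := by
    intro j h
    have := hDs (d ⟨j, h⟩).2
    simpa using this
  have hwk : w k = t := by simp [w]
  have := costF_mct_seq hC hT c w k ?_ ?_ C ?_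
  · rw [hwk] at this
    refine this.mono ?_
    rw [hk]; push_cast; nlinarith
  · intro i hi j hj h
    by_cases h1 : i < k <;> by_cases h2 : j < k
    · simp only [w, h1, h2, dif_pos] at h
      have := d.injective (Subtype.ext h)
      simpa using this
    · simp only [w, h1, h2, dif_pos, dif_neg, not_false_eq_true] at h
      exact absurd h (hdm _ _).1
    · simp only [w, h1, h2, dif_pos, dif_neg, not_false_eq_true] at h
      exact absurd h.symm (hdm _ _).1
    · omega
  · intro i hi j hj h
    have hci : c i ∈ C := by
      simp only [c, show i < k + 1 by omega, dif_pos]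
      exact (e _).2
    rw [h] at hci
    by_cases h2 : j < k
    · simp only [w, h2, dif_pos] at hci
      exact (hdm _ _).2 hci
    · simp only [w, h2, dif_neg, not_false_eq_true] at hci
      exact ht hci
  · intro i
    constructor
    · intro hi
      refine ⟨(e.symm ⟨i, hi⟩ : Fin (k+1)), by omega, ?_⟩
      have h7 : ((e.symm ⟨i, hi⟩ : Fin (k+1)) : ℕ) < k + 1 := (e.symm ⟨i, hi⟩).2
      simp only [c, h7, dif_pos]
      simp
    · rintro ⟨j, hj, rfl⟩
      simp only [c, show j < k + 1 by omega, dif_pos]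
      exact (e _).2

/-- Commutator identity. -/
theorem mct_commutator (C1 C2 : Finset (Fin n)) (t d : Fin n) (htd : d ≠ t)
    (h1t : t ∉ C1) (h2t : t ∉ C2) (h1d : d ∉ C1) (h2d : d ∉ C2) (x : Fin n → Bool) :
    mct (insert d C2) t (mct C1 d (mct (insert d C2) t (mct C1 d x))) = mct (C1 ∪ C2) t x := by
  have hC : ∀ (C : Finset (Fin n)) (s : Fin n) (C' : Finset (Fin n)) (y : Fin n → Bool), s ∉ C →
      ((∀ i ∈ C, mct C' s y i = true) ↔ (∀ i ∈ C, y i = true)) := by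
    intro C s C' y hs
    exact forall₂_congr fun i hi => by
      rw [mct_ne]
      rintro rfl
      exact hs hi
  funext i
  by_cases hi : i = t
  · subst hi
    simp only [mct_self, mct_ne htd, mct_ne htd.symm, Finset.forall_mem_insert, hC _ _ _ _ h1t,
      hC _ _ _ _ h2t, hC _ _ _ _ h1d, hC _ _ _ _ h2d, Finset.mem_union, or_imp, forall_and]
    exact bool_aux2 _ _ _ _
  · rw [mct_ne hi, mct_ne hi]
    by_cases hid : i = d
    · subst hid
      simp only [mct_self, mct_ne htd, hC _ _ _ _ h1t, hC _ _ _ _ h1d]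
      simp
    · rw [mct_ne hid, mct_ne hi, mct_ne hid]

/-- Multi-controlled NOT with one dirty wire. -/
theorem costF_mct_big (hC : 0 < WC) (hT : 0 < WT) (C : Finset (Fin n)) (t d : Fin n)
    (ht : t ∉ C) (hd : d ∉ C) (htd : d ≠ t) :
    CostF WC WT (mct C t) (16 * n * (WC + WT)) := by
  have hcn : C.card + 2 ≤ n := by
    have := Finset.card_le_univ (insert d (insert t C))
    rw [Finset.card_insert_of_notMem (by simp [htd, hd]), Finset.card_insert_of_notMem ht,
      Fintype.card_fin] at this
    omega
  obtain ⟨C1, hs, hc1⟩ := Finset.exists_subset_card_eq (s := C) (n := (C.card + 1) / 2) (by omega)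
  have hc2 : (C \ C1).card = C.card - (C.card + 1) / 2 := by
    rw [Finset.card_sdiff_of_subset hs, hc1]
  have hd2 : d ∉ C \ C1 := fun h => hd (Finset.sdiff_subset h)
  have ht2 : t ∉ C \ C1 := fun h => ht (Finset.sdiff_subset h)
  have hi : (insert d (C \ C1)).card = C.card - (C.card + 1) / 2 + 1 := by
    rw [Finset.card_insert_of_notMem hd2, hc2]
  have hA : CostF WC WT (mct C1 d) (4 * n * (WC + WT)) := by
    refine (costF_mct_small hC hT C1 d (fun h => hd (hs h)) (by omega)).mono ?_
    have : (C1.card : ℝ) + 1 ≤ n := by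
      have : C1.card + 1 ≤ n := by omega
      exact_mod_cast this
    nlinarith
  have hB : CostF WC WT (mct (insert d (C \ C1)) t) (4 * n * (WC + WT)) := by
    refine (costF_mct_small hC hT _ t (by simp [htd.symm, ht]) (by omega)).mono ?_
    have : ((insert d (C \ C1)).card : ℝ) + 1 ≤ n := by
      have : (insert d (C \ C1)).card + 1 ≤ n := by omega
      exact_mod_cast this
    nlinarith
  refine ((hB.comp (hA.comp (hB.comp hA))).mono (by linarith)).congr fun x => ?_
  rw [mct_commutator C1 (C \ C1) t d htd (fun h => ht (hs h)) ht2 (fun h => hd (hs h)) hd2,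
    Finset.union_sdiff_of_subset hs]

end
end RevCirc
namespace RevCirc
section
variable {n : ℕ} {WC WT : ℝ}

/-- Linear reduction: all points of `P` become zero outside a small set of wires. -/
theorem exists_reduce (hC : 0 < WC) (r B : ℕ) (P : Finset (Fin n → Bool))
    (hP : P.card ≤ B * r) :
    ∃ (f : (Fin n → Bool) → (Fin n → Bool)) (M : Finset (Fin n)),
      CostF WC WT f (B * n * WC) ∧ M.card ≤ B * 2 ^ r ∧
      ∀ x ∈ P, ∀ i, i ∉ M → f x i = false := by
  induction B generalizing P with
  | zero =>
    refine ⟨fun x => x, ∅, CostF.id_zero.mono (by simp), by simp, ?_⟩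
    have : P = ∅ := by
      rw [← Finset.card_eq_zero]; omega
    simp [this]
  | succ B ih =>
    obtain ⟨P0, hP0, hP0c⟩ := Finset.exists_subset_card_eq (s := P) (n := min r P.card) (by omega)
    have hrest : (P \ P0).card ≤ B * r := by
      rw [Finset.card_sdiff_of_subset hP0, hP0c]
      have : (B + 1) * r = B * r + r := by ring
      omega
    obtain ⟨f, M, hf, hM, hfM⟩ := ih _ hrest
    let col : Fin n → (↥P0 → Bool) := fun j p => f p.1 j
    have hrep : ∀ j : Fin n, ∃ k : Fin n, j ∉ M → (k ∉ M ∧ col k = col j) :=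
      fun j => ⟨j, fun h => ⟨h, rfl⟩⟩
    classical
    let rep : (↥P0 → Bool) → Option (Fin n) := fun v =>
      if h : ∃ k : Fin n, k ∉ M ∧ col k = v then some h.choose else none
    have hrepj : ∀ j, j ∉ M → ∃ k, rep (col j) = some k ∧ k ∉ M ∧ col k = col j := by
      intro j hj
      have h : ∃ k : Fin n, k ∉ M ∧ col k = col j := ⟨j, hj, rfl⟩
      exact ⟨h.choose, by simp only [rep]; rw [dif_pos h], h.choose_spec⟩
    let rp : Fin n → Fin n := fun j => (rep (col j)).getD j
    have hrp : ∀ j, j ∉ M → rep (col j) = some (rp j) ∧ rp j ∉ M ∧ col (rp j) = col j := by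
      intro j hj
      obtain ⟨k, h1, h2⟩ := hrepj j hj
      have : rp j = k := by simp [rp, h1]
      rw [this]; exact ⟨h1, h2⟩
    let R : Finset (Fin n) := (Mᶜ).image rp
    have hRc : R.card ≤ 2 ^ r := by
      have h1 : (R.map ⟨some, Option.some_injective _⟩ : Finset (Option (Fin n))) ⊆
          Finset.univ.image rep := by
        intro o ho
        simp only [R, Finset.mem_map, Finset.mem_image, Finset.mem_compl,
          Function.Embedding.coeFn_mk] at ho
        obtain ⟨k, ⟨j, hj, rfl⟩, rfl⟩ := ho
        exact Finset.mem_image.2 ⟨col j, Finset.mem_univ _, (hrp j hj).1⟩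
      have h2 := Finset.card_le_card h1
      rw [Finset.card_map] at h2
      refine h2.trans (Finset.card_image_le.trans ?_)
      rw [Finset.card_univ, Fintype.card_fun, Fintype.card_bool, Fintype.card_coe, hP0c]
      exact Nat.pow_le_pow_right (by norm_num) (min_le_left _ _)
    let J : Finset (Fin n) := Mᶜ \ R
    have hJ : ∀ j, j ∈ J ↔ j ∉ M ∧ j ∉ R := fun j => by simp [J]
    have hlayer : CostF WC WT (layer J (fun j => {rp j})) (J.card * WC) := by
      apply costF_layer
      · simp
      · intro j hj i hi
        rw [Finset.mem_singleton] at hi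
        subst hi
        rw [hJ]
        intro h
        exact h.2 (Finset.mem_image.2 ⟨j, by simpa using ((hJ j).1 hj).1, rfl⟩)
    refine ⟨_, M ∪ R, (hlayer.comp hf).mono ?_, ?_, ?_⟩
    · have : (J.card : ℝ) ≤ n := by
        have := Finset.card_le_univ J
        rw [Fintype.card_fin] at this
        exact_mod_cast this
      push_cast
      nlinarith
    · refine (Finset.card_union_le _ _).trans ?_
      have : (B + 1) * 2 ^ r = B * 2 ^ r + 2 ^ r := by ring
      omega
    · intro x hx i hi
      rw [Finset.mem_union, not_or] at hi
      rw [layer_of_mem ((hJ i).2 hi)]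
      obtain ⟨-, h1, h2⟩ := hrp i hi.1
      by_cases hx0 : x ∈ P0
      · have : f x (rp i) = f x i := congrFun h2 ⟨x, hx0⟩
        simp [this]
      · have hx' : x ∈ P \ P0 := Finset.mem_sdiff.2 ⟨hx, hx0⟩
        simp [hfM x hx' i hi.1, hfM x hx' _ h1]

/-- Local transposition on the wires of `M`. -/
theorem exists_local_swap (hC : 0 < WC) (hT : 0 < WT) (M : Finset (Fin n)) (hM : 2 * M.card ≤ n)
    (a b : Fin n → Bool) (hab : ∀ i, i ∉ M → a i = b i) :
    ∃ f : (Fin n → Bool) → (Fin n → Bool), CostF WC WT f (8 * M.card * (WC + WT)) ∧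
      f a = b ∧ f b = a ∧ ∀ z, (∀ i, i ∉ M → z i = a i) → z ≠ a → z ≠ b → f z = z := by
  by_cases hne : a = b
  · subst hne
    refine ⟨fun x => x, CostF.id_zero.mono (by positivity), rfl, rfl, fun _ _ _ _ => rfl⟩
  obtain ⟨t, ht⟩ := Function.ne_iff.1 hne
  have htM : t ∈ M := by
    by_contra h; exact ht (hab t h)
  let D : Finset (Fin n) := M.filter (fun j => j ≠ t ∧ a j ≠ b j)
  let S : Fin n → Finset (Fin n) := fun _ => {t}
  have hD : ∀ j ∈ D, ∀ i ∈ S j, i ∉ D := by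
    intro j _ i hi
    simp only [S, Finset.mem_singleton] at hi
    subst hi
    simp [D]
  let N : Finset (Fin n) := M.filter (fun j => j ≠ t ∧ layer D S a j = false)
  let E : Fin n → Finset (Fin n) := fun _ => ∅
  have hN : ∀ j ∈ N, ∀ i ∈ E j, i ∉ N := by simp [E]
  have hDc : CostF WC WT (layer D S) (M.card * WC) :=
    (costF_layer D S (by simp [S]) hD).mono
      (mul_le_mul_of_nonneg_right (by exact_mod_cast Finset.card_filter_le _ _) hC.le)
  have hNc : CostF WC WT (layer N E) (M.card * WC) :=
    (costF_layer N E (by simp [E]) hN).mono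
      (mul_le_mul_of_nonneg_right (by exact_mod_cast Finset.card_filter_le _ _) hC.le)
  have hMc : CostF WC WT (mct (M.erase t) t) (4 * M.card * (WC + WT)) := by
    have h1 := Finset.card_erase_add_one htM
    refine (costF_mct_small hC hT (M.erase t) t (by simp) (by omega)).mono ?_
    rw [← h1]; push_cast; exact le_rfl
  let y : (Fin n → Bool) → (Fin n → Bool) := fun z => layer N E (layer D S z)
  have hyinj : Function.Injective y := (hNc.comp hDc).injective
  have hyy : ∀ z, layer D S (layer N E (y z)) = z := by
    intro z
    simp only [y]
    rw [layer_layer N E hN, layer_layer D S hD]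
  have htD : t ∉ D := by simp [D]
  have htN : t ∉ N := by simp [N]
  have hyt : ∀ z, y z t = z t := by
    intro z
    simp only [y]
    rw [layer_of_notMem htN, layer_of_notMem htD]
  have hyout : ∀ z i, i ∉ M → y z i = z i := by
    intro z i hi
    simp only [y]
    rw [layer_of_notMem (by simp [N, hi]), layer_of_notMem (by simp [D, hi])]
  have hya : ∀ i ∈ M, i ≠ t → y a i = true := by
    intro i hi hit
    simp only [y]
    by_cases h : layer D S a i = false
    · rw [layer_of_mem (by simp [N, hi, hit, h]), h]; simp [E]
    · rw [layer_of_notMem (by simp [N, h])]; simpa using h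
  have hDab : ∀ i, i ≠ t → layer D S a i = layer D S b i := by
    intro i hit
    by_cases hi : i ∈ D
    · rw [layer_of_mem hi, layer_of_mem hi]
      have h2 : a i ≠ b i := by
        simp only [D, Finset.mem_filter] at hi
        exact hi.2.2
      simp only [S, Finset.mem_singleton, forall_eq]
      revert ht h2
      cases a i <;> cases b i <;> cases a t <;> cases b t <;> simp
    · rw [layer_of_notMem hi, layer_of_notMem hi]
      by_cases hiM : i ∈ M
      · by_contra h
        exact hi (by simp [D, hiM, hit, h])
      · exact hab i hiM
  have hyab : ∀ i, i ≠ t → y a i = y b i := by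
    intro i hit
    simp only [y]
    by_cases hi : i ∈ N
    · rw [layer_of_mem hi, layer_of_mem hi, hDab i hit]; simp [E]
    · rw [layer_of_notMem hi, layer_of_notMem hi, hDab i hit]
  have hmab : mct (M.erase t) t (y a) = y b := by
    funext i
    by_cases hi : i = t
    · subst hi
      rw [mct_self, hyt, hyt]
      have : ∀ j ∈ M.erase i, y a j = true := fun j hj =>
        hya j (Finset.mem_of_mem_erase hj) (Finset.ne_of_mem_erase hj)
      rw [decide_eq_true this]
      revert ht
      cases a i <;> cases b i <;> simp
    · rw [mct_ne hi, hyab i hi]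
  have hmba : mct (M.erase t) t (y b) = y a := by
    funext i
    by_cases hi : i = t
    · subst hi
      rw [mct_self, hyt, hyt]
      have : ∀ j ∈ M.erase i, y b j = true := fun j hj => by
        rw [← hyab j (Finset.ne_of_mem_erase hj)]
        exact hya j (Finset.mem_of_mem_erase hj) (Finset.ne_of_mem_erase hj)
      rw [decide_eq_true this]
      revert ht
      cases a i <;> cases b i <;> simp
    · rw [mct_ne hi, hyab i hi]
  refine ⟨fun z => layer D S (layer N E (mct (M.erase t) t (y z))),
    (hDc.comp (hNc.comp (hMc.comp (hNc.comp hDc)))).mono ?_, ?_, ?_, ?_⟩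
  · have : (0 : ℝ) ≤ M.card := by positivity
    nlinarith
  · show layer D S (layer N E (mct (M.erase t) t (y a))) = b
    rw [hmab, hyy]
  · show layer D S (layer N E (mct (M.erase t) t (y b))) = a
    rw [hmba, hyy]
  · intro z hz hza hzb
    show layer D S (layer N E (mct (M.erase t) t (y z))) = z
    by_cases hall : ∀ j ∈ M.erase t, y z j = true
    · exfalso
      have hoff : ∀ i, i ≠ t → y z i = y a i := by
        intro i hit
        by_cases hi : i ∈ M
        · rw [hall i (Finset.mem_erase.2 ⟨hit, hi⟩), hya i hi hit]
        · rw [hyout z i hi, hyout a i hi, hz i hi]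
      by_cases h1 : z t = a t
      · apply hza
        apply hyinj
        funext i
        by_cases hi : i = t
        · rw [hi, hyt, hyt, h1]
        · exact hoff i hi
      · apply hzb
        apply hyinj
        funext i
        by_cases hi : i = t
        · rw [hi, hyt, hyt]
          revert h1 ht
          cases z t <;> cases a t <;> cases b t <;> simp
        · rw [hoff i hi, hyab i hi]
    · have : mct (M.erase t) t (y z) = y z := by
        funext i
        by_cases hi : i = t
        · subst hi
          rw [mct_self, decide_eq_false hall]; simp
        · rw [mct_ne hi]
      rw [this, hyy]

/-- Moving finitely many points to prescribed places, locally on `M`. -/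
theorem exists_move {ι : Type*} [DecidableEq ι] (hC : 0 < WC) (hT : 0 < WT) (M : Finset (Fin n))
    (hM : 2 * M.card ≤ n) (e : Fin n → Bool) (P Q : ι → Fin n → Bool)
    (hPi : Function.Injective P) (hQi : Function.Injective Q)
    (hP : ∀ i j, j ∉ M → P i j = e j) (hQ : ∀ i j, j ∉ M → Q i j = e j) (s : Finset ι) :
    ∃ f : (Fin n → Bool) → (Fin n → Bool), CostF WC WT f (s.card * (8 * M.card * (WC + WT))) ∧
      (∀ i ∈ s, f (P i) = Q i) ∧
      (∀ z, (∀ j, j ∉ M → z j = e j) → ∀ j, j ∉ M → f z j = e j) := by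
  induction s using Finset.induction_on with
  | empty => exact ⟨fun x => x, CostF.id_zero.mono (by simp), by simp, fun z h => h⟩
  | insert a s ha ih =>
    obtain ⟨f, hf, hf1, hf2⟩ := ih
    have hfa := hf2 (P a) (hP a)
    obtain ⟨g, hg, hg1, hg2, hg3⟩ := exists_local_swap hC hT M hM (f (P a)) (Q a)
      (fun i hi => (hfa i hi).trans (hQ a i hi).symm)
    refine ⟨_, (hg.comp hf).mono ?_, ?_, ?_⟩
    · rw [Finset.card_insert_of_notMem ha]; push_cast; linarith
    · intro i hi
      rcases Finset.mem_insert.1 hi with rfl | hi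
      · exact hg1
      · have hia : i ≠ a := fun h => ha (h ▸ hi)
        have : f (P i) ≠ f (P a) := fun h => hia (hPi (hf.injective h))
        rw [hf1 i hi] at this ⊢
        exact hg3 _ (fun j hj => (hQ i j hj).trans (hfa j hj).symm) this (fun h => hia (hQi h))
    · intro z hz
      have hfz := hf2 z hz
      by_cases h1 : f z = f (P a)
      · rw [h1, hg1]; exact hQ a
      by_cases h2 : f z = Q a
      · rw [h2, hg2]; exact hfa
      rw [hg3 _ (fun i hi => (hfz i hi).trans (hfa i hi).symm) h1 h2]
      exact hfz

/-- The cost of a group of `2 ^ k` disjoint transpositions. -/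
noncomputable def groupCost (WC WT : ℝ) (n k r B : ℕ) : ℝ :=
  2 * B * n * WC + 18 * n * (WC + WT) + 2 ^ (k + 5) * (B * 2 ^ r) * (WC + WT)

theorem exists_group (hC : 0 < WC) (hT : 0 < WT) (k r B : ℕ) (hk : 1 ≤ k)
    (x : (Fin k → Bool) × Bool → (Fin n → Bool)) (hx : Function.Injective x)
    (hBr : 2 ^ (k + 1) ≤ B * r) (hBn : 2 * (B * 2 ^ r) ≤ n) :
    ∃ p : Equiv.Perm (Fin n → Bool), CostF WC WT p (groupCost WC WT n k r B) ∧
      CostF WC WT p.symm (groupCost WC WT n k r B) ∧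
      (∀ i b, p (x (i, b)) = x (i, !b)) ∧ (∀ z, z ∉ Set.range x → p z = z) := by
  classical
  have hcard : (Finset.univ.image x).card ≤ B * r := by
    refine Finset.card_image_le.trans (le_trans ?_ hBr)
    rw [Finset.card_univ]
    simp [pow_succ]
  obtain ⟨f, M, hf, hM, hfM⟩ := exists_reduce (WC := WC) (WT := WT) hC r B _ hcard
  have hM2 : 2 * M.card ≤ n := by omega
  have hnot : CostF WC WT (layer Mᶜ (fun _ => ∅)) (n * WC) :=
    (costF_layer Mᶜ (fun _ => ∅) (by simp) (by simp)).mono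
      (mul_le_mul_of_nonneg_right (by
        have := Finset.card_le_univ Mᶜ
        rw [Fintype.card_fin] at this
        exact_mod_cast this) hC.le)
  have hg := hnot.comp hf
  set g : (Fin n → Bool) → (Fin n → Bool) := fun z => layer Mᶜ (fun _ => ∅) (f z) with hgdef
  have hgx : ∀ i j, j ∉ M → g (x i) j = true := by
    intro i j hj
    simp only [hgdef]
    rw [layer_of_mem (by simpa using hj),
      hfM (x i) (Finset.mem_image_of_mem _ (Finset.mem_univ _)) j hj]
    simp
  have hPi : Function.Injective (fun i => g (x i)) := hg.injective.comp hx
  have hMk : k + 1 ≤ M.card := by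
    have hinj : Function.Injective (fun (i : (Fin k → Bool) × Bool) (j : ↥M) => g (x i) j.1) := by
      intro i i' h
      apply hPi
      funext j
      by_cases hj : j ∈ M
      · exact congrFun h ⟨j, hj⟩
      · show g (x i) j = g (x i') j
        rw [hgx i j hj, hgx i' j hj]
    have h1 := Fintype.card_le_of_injective _ hinj
    simp only [Fintype.card_prod, Fintype.card_fun, Fintype.card_bool, Fintype.card_fin,
      Fintype.card_coe] at h1
    rw [← pow_succ] at h1
    exact (Nat.pow_le_pow_iff_right (by norm_num)).1 h1
  obtain ⟨φ0⟩ := Function.Embedding.nonempty_of_card_le (α := Option (Fin k)) (β := ↥M)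
    (by simpa using hMk)
  let φ : Option (Fin k) → Fin n := fun o => (φ0 o).1
  have hφ : Function.Injective φ := Subtype.val_injective.comp φ0.injective
  have hφM : ∀ o, φ o ∈ M := fun o => (φ0 o).2
  let Q : (Fin k → Bool) × Bool → (Fin n → Bool) := fun ib =>
    Function.extend φ (fun o => o.elim ib.2 ib.1) (fun _ => true)
  have hQφ : ∀ ib o, Q ib (φ o) = o.elim ib.2 ib.1 := fun ib o => hφ.extend_apply _ _ _
  have hQo : ∀ ib j, (¬ ∃ o, φ o = j) → Q ib j = true := fun ib j h =>
    Function.extend_apply' _ _ _ h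
  have hQi : Function.Injective Q := by
    rintro ⟨i, b⟩ ⟨i', b'⟩ h
    have h1 := congrFun h (φ none)
    rw [hQφ, hQφ] at h1
    have h2 : i = i' := by
      funext l
      have h1 := congrFun h (φ (some l))
      rw [hQφ, hQφ] at h1
      exact h1
    simp only [Option.elim] at h1
    rw [h1, h2]
  obtain ⟨u, hu, hu1, -⟩ := exists_move hC hT M hM2 (fun _ => true) (fun i => g (x i)) Q hPi hQi hgx
    (fun ib j hj => hQo ib j (by rintro ⟨o, rfl⟩; exact hj (hφM o))) Finset.univ
  obtain ⟨v, hv, hv1, hv2⟩ := (hu.comp hg).exists_perm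
  have hvx : ∀ i, v (x i) = Q i := fun i => by rw [hv]; exact hu1 i (Finset.mem_univ _)
  let t := φ none
  let d := φ (some ⟨0, by omega⟩)
  let C : Finset (Fin n) := (Finset.univ.image φ)ᶜ
  have hCm : ∀ j, j ∈ C ↔ ¬ ∃ o, φ o = j := by intro j; simp [C]
  have hmct := costF_mct_big hC hT C t d (by rw [hCm]; exact fun h => h ⟨_, rfl⟩)
    (by rw [hCm]; exact fun h => h ⟨_, rfl⟩) (fun h => by simpa using hφ h)
  have hmQ : ∀ i b, mct C t (Q (i, b)) = Q (i, !b) := by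
    intro i b
    funext j
    by_cases hj : ∃ o, φ o = j
    · obtain ⟨o, rfl⟩ := hj
      cases o with
      | none =>
        show mct C t _ t = _
        rw [mct_self, decide_eq_true (fun j hj => hQo _ j ((hCm j).1 hj))]
        simp only [t]
        rw [hQφ, hQφ]; simp
      | some l =>
        rw [mct_ne (fun h => by simpa using hφ h), hQφ, hQφ]; rfl
    · rw [mct_ne (fun h => hj ⟨none, h.symm⟩), hQo _ _ hj, hQo _ _ hj]
  have hmz : ∀ z, z ∉ Set.range Q → mct C t z = z := by
    intro z hz
    have hall : ¬ ∀ j ∈ C, z j = true := by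
      intro h
      apply hz
      refine ⟨(fun l => z (φ (some l)), z (φ none)), ?_⟩
      funext j
      by_cases hj : ∃ o, φ o = j
      · obtain ⟨o, rfl⟩ := hj
        rw [hQφ]
        cases o <;> rfl
      · rw [hQo _ _ hj, h j ((hCm j).2 hj)]
    funext j
    by_cases hj : j = t
    · subst hj
      rw [mct_self, decide_eq_false hall]; simp
    · rw [mct_ne hj]
  obtain ⟨p, hp, hp1, hp2⟩ := (hv2.comp (hmct.comp hv1)).exists_perm
  have hle : (Finset.univ : Finset ((Fin k → Bool) × Bool)).card * (8 * M.card * (WC + WT)) +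
      (n * WC + B * n * WC) + (16 * n * (WC + WT) + ((Finset.univ : Finset ((Fin k → Bool) × Bool)).card * (8 * M.card * (WC + WT)) +
      (n * WC + B * n * WC))) ≤ groupCost WC WT n k r B := by
    have h1 : ((Finset.univ : Finset ((Fin k → Bool) × Bool)).card : ℝ) = 2 ^ (k + 1) := by
      rw [Finset.card_univ]; simp [pow_succ]
    have h2 : (M.card : ℝ) ≤ B * 2 ^ r := by exact_mod_cast hM
    have h3 : (2 : ℝ) ^ (k+1) * (8 * M.card * (WC + WT)) ≤ 2 ^ (k+1) * (8 * (B * 2 ^ r) * (WC + WT)) := by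
      have : 0 < WC + WT := by linarith
      gcongr
    have h4 : (2 : ℝ) ^ (k + 5) = 2 ^ (k + 1) * 16 := by rw [show k + 5 = k + 1 + 4 by ring, pow_add]; norm_num
    have h5 : 0 ≤ (n : ℝ) * WT := by positivity
    rw [h1, groupCost, h4]
    linarith
  refine ⟨p, hp1.mono hle, hp2.mono hle, ?_, ?_⟩
  · intro i b
    rw [hp, hvx, hmQ, ← hvx, Equiv.symm_apply_apply]
  · intro z hz
    rw [hp, hmz, Equiv.symm_apply_apply]
    rintro ⟨i, hi⟩
    apply hz
    refine ⟨i, v.injective ?_⟩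
    rw [hvx, hi]

end
end RevCirc
namespace RevCirc
section
variable {n : ℕ} {WC WT : ℝ}

open Equiv in
theorem sign_mct (hn : 4 ≤ n) (C : Finset (Fin n)) (t : Fin n) (hCc : C.card ≤ 2) (ht : t ∉ C)
    (p : Equiv.Perm (Fin n → Bool)) (hp : ∀ x, p x = mct C t x) : Equiv.Perm.sign p = 1 := by
  obtain ⟨d, hd⟩ : ∃ d : Fin n, d ∉ insert t C := by
    by_contra h
    push Not at h
    have h1 : (Finset.univ : Finset (Fin n)) ⊆ insert t C := fun i _ => h i
    have h2 := Finset.card_le_card h1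
    rw [Finset.card_insert_of_notMem ht, Finset.card_univ, Fintype.card_fin] at h2
    omega
  rw [Finset.mem_insert, not_or] at hd
  have hsplit : ∃ C1 ⊆ C, C1.card ≤ 2 ∧ (C \ C1).card ≤ 1 := by
    obtain ⟨C1, h1, h2⟩ := Finset.exists_subset_card_eq (s := C) (n := C.card - 1) (by omega)
    refine ⟨C1, h1, by omega, ?_⟩
    rw [Finset.card_sdiff_of_subset h1]; omega
  obtain ⟨C1, hs, hc1, hc2⟩ := hsplit
  have ht2 : t ∉ C \ C1 := fun h => ht (Finset.sdiff_subset h)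
  have hd2 : d ∉ C \ C1 := fun h => hd.2 (Finset.sdiff_subset h)
  obtain ⟨a, ha, -⟩ := (costF_gate (WC := 1) (WT := 1) (C := C1) (t := d) hc1
    (fun h => hd.2 (hs h))).exists_perm
  obtain ⟨b, hb, -⟩ := (costF_gate (WC := 1) (WT := 1) (C := insert d (C \ C1)) (t := t)
    ((Finset.card_insert_le _ _).trans (by omega)) (by simp [Ne.symm hd.1, ht])).exists_perm
  have : p = b * a * b * a := by
    ext1 x
    rw [hp]
    simp only [Equiv.Perm.mul_apply, ha, hb]
    rw [mct_commutator C1 (C \ C1) t d hd.1 (fun h => ht (hs h)) ht2 (fun h => hd.2 (hs h)) hd2,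
      Finset.union_sdiff_of_subset hs]
  rw [this]
  simp only [map_mul]
  rcases Int.units_eq_one_or (Equiv.Perm.sign a) with h1 | h1 <;>
    rcases Int.units_eq_one_or (Equiv.Perm.sign b) with h2 | h2 <;> rw [h1, h2] <;> rfl

theorem sign_circPerm (hn : 4 ≤ n) (c : List (Gate n)) : Equiv.Perm.sign (circPerm c) = 1 := by
  induction c with
  | nil =>
    have : circPerm ([] : List (Gate n)) = 1 := by ext1 x; rfl
    rw [this, map_one]
  | cons g c ih =>
    have : circPerm (g :: c) = circPerm c * circPerm [g] := by
      ext1 x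
      rw [Equiv.Perm.mul_apply]
      exact evalCircuit_cons g c x
    rw [this, map_mul, ih, one_mul]
    exact sign_mct hn g.controls g.target g.2.1 g.2.2 _ (fun x => rfl)

theorem CostF.sign (hn : 4 ≤ n) {p : Equiv.Perm (Fin n → Bool)} {a : ℝ} (h : CostF WC WT p a) :
    Equiv.Perm.sign p = 1 := by
  obtain ⟨c, hc, -⟩ := h
  have : p = circPerm c := by ext1 x; exact (hc x).symm
  rw [this]; exact sign_circPerm hn c

theorem costF_pair (hC : 0 < WC) (hT : 0 < WT) (hn : 32 ≤ n) (a b c d : Fin n → Bool)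
    (hab : a ≠ b) (hac : a ≠ c) (had : a ≠ d) (hbc : b ≠ c) (hbd : b ≠ d) (hcd : c ≠ d) :
    CostF WC WT (Equiv.swap a b * Equiv.swap c d : Equiv.Perm (Fin n → Bool))
      (groupCost WC WT n 1 4 1) := by
  let x : (Fin 1 → Bool) × Bool → (Fin n → Bool) := fun ib =>
    if ib.1 0 then (if ib.2 then a else b) else (if ib.2 then c else d)
  have hx : Function.Injective x := by
    rintro ⟨i, s⟩ ⟨i', s'⟩ h
    have : i 0 = i' 0 ∧ s = s' := by
      revert h
      simp only [x]
      cases i 0 <;> cases i' 0 <;> cases s <;> cases s' <;>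
        simp [hab, hac, had, hbc, hbd, hcd, hab.symm, hac.symm, had.symm, hbc.symm, hbd.symm, hcd.symm]
    obtain ⟨h1, h2⟩ := this
    have : i = i' := by
      funext l
      rw [Subsingleton.elim l 0, h1]
    rw [this, h2]
  obtain ⟨p, hp, -, hp1, hp2⟩ := exists_group (WC := WC) (WT := WT) hC hT 1 4 1 le_rfl x hx
    (by norm_num) (by omega)
  refine hp.congr fun z => ?_
  have e1 : p a = b := hp1 (fun _ => true) true
  have e2 : p b = a := hp1 (fun _ => true) false
  have e3 : p c = d := hp1 (fun _ => false) true
  have e4 : p d = c := hp1 (fun _ => false) false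
  rw [Equiv.Perm.mul_apply]
  by_cases h1 : z = a
  · subst h1; rw [Equiv.swap_apply_of_ne_of_ne hac had, Equiv.swap_apply_left, e1]
  by_cases h2 : z = b
  · subst h2; rw [Equiv.swap_apply_of_ne_of_ne hbc hbd, Equiv.swap_apply_right, e2]
  by_cases h3 : z = c
  · subst h3; rw [Equiv.swap_apply_left, Equiv.swap_apply_of_ne_of_ne had.symm hbd.symm, e3]
  by_cases h4 : z = d
  · subst h4; rw [Equiv.swap_apply_right, Equiv.swap_apply_of_ne_of_ne hac.symm hbc.symm, e4]
  rw [Equiv.swap_apply_of_ne_of_ne h3 h4, Equiv.swap_apply_of_ne_of_ne h1 h2]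
  apply hp2
  rintro ⟨⟨i, s⟩, h⟩
  revert h
  simp only [x]
  cases i 0 <;> cases s <;> simp [Ne.symm h1, Ne.symm h2, Ne.symm h3, Ne.symm h4]

theorem groupCost_nonneg (hC : 0 < WC) (hT : 0 < WT) (k r B : ℕ) :
    0 ≤ groupCost WC WT n k r B := by
  unfold groupCost; positivity

theorem costF_two_swaps (hC : 0 < WC) (hT : 0 < WT) (hn : 32 ≤ n) (a b c d : Fin n → Bool)
    (hab : a ≠ b) (hcd : c ≠ d) :
    CostF WC WT (Equiv.swap a b * Equiv.swap c d : Equiv.Perm (Fin n → Bool))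
      (2 * groupCost WC WT n 1 4 1) := by
  have hex : ∀ s : Finset (Fin n → Bool), s.card ≤ 5 → ∃ e, e ∉ s := by
    intro s hs
    by_contra h
    push Not at h
    have h1 : (Finset.univ : Finset (Fin n → Bool)) ⊆ s := fun i _ => h i
    have h2 := Finset.card_le_card h1
    rw [Finset.card_univ, Fintype.card_fun, Fintype.card_bool, Fintype.card_fin] at h2
    have : 2 ^ 3 ≤ 2 ^ n := Nat.pow_le_pow_right (by norm_num) (by omega : 3 ≤ n)
    omega
  obtain ⟨e, he⟩ := hex {a, b, c, d} (Finset.card_le_four.trans (by norm_num))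
  obtain ⟨f, hf⟩ := hex {e, a, b, c, d} (Finset.card_le_five)
  simp only [Finset.mem_insert, Finset.mem_singleton, not_or] at he hf
  have h1 := costF_pair hC hT hn a b e f hab (Ne.symm he.1) (Ne.symm hf.2.1) (Ne.symm he.2.1)
    (Ne.symm hf.2.2.1) (Ne.symm hf.1)
  have h2 := costF_pair hC hT hn e f c d (Ne.symm hf.1) he.2.2.1 he.2.2.2 hf.2.2.2.1 hf.2.2.2.2 hcd
  refine ((h1.comp h2).mono (by linarith)).congr fun x => ?_
  simp only [Equiv.Perm.mul_apply, Equiv.swap_apply_self]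

theorem costF_rest (hC : 0 < WC) (hT : 0 < WT) (hn : 32 ≤ n) (h : Equiv.Perm (Fin n → Bool))
    (hs : Equiv.Perm.sign h = 1) :
    CostF WC WT h (h.support.card * (2 * groupCost WC WT n 1 4 1)) := by
  induction hm : h.support.card using Nat.strong_induction_on generalizing h with
  | _ m ih =>
    have hG := groupCost_nonneg (n := n) hC hT 1 4 1
    by_cases h1 : h = 1
    · subst h1
      exact (CostF.id_zero.mono (by positivity)).congr fun x => rfl
    obtain ⟨a, ha⟩ : ∃ a, h a ≠ a := by
      by_contra hh
      push Not at hh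
      exact h1 (Equiv.ext hh)
    set h' := Equiv.swap a (h a) * h with hh'
    have hs' : Equiv.Perm.sign h' = -1 := by
      rw [hh', map_mul, Equiv.Perm.sign_swap (Ne.symm ha), hs, mul_one]
    have h2 : h' ≠ 1 := by
      intro h3
      rw [h3, map_one] at hs'
      exact absurd hs' (by decide)
    obtain ⟨b, hb⟩ : ∃ b, h' b ≠ b := by
      by_contra hh
      push Not at hh
      exact h2 (Equiv.ext hh)
    set h'' := Equiv.swap b (h' b) * h' with hh''
    have hs'' : Equiv.Perm.sign h'' = 1 := by
      rw [hh'', map_mul, Equiv.Perm.sign_swap (Ne.symm hb), hs']; rfl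
    have c1 := Equiv.Perm.card_support_swap_mul ha
    have c2 := Equiv.Perm.card_support_swap_mul hb
    rw [← hh'] at c1
    rw [← hh''] at c2
    have hrec := ih h''.support.card (by omega) h'' hs'' rfl
    have hsw := costF_two_swaps hC hT hn a (h a) b (h' b) (Ne.symm ha) (Ne.symm hb)
    refine ((hsw.comp hrec).mono ?_).congr fun x => ?_
    · have : (h''.support.card : ℝ) + 1 ≤ m := by
        have : h''.support.card + 1 ≤ m := by omega
        exact_mod_cast this
      nlinarith
    · rw [hh'', hh']
      simp only [Equiv.Perm.mul_apply, Equiv.swap_apply_self]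

theorem exists_independent {X : Type*} [Fintype X] [DecidableEq X] (h : Equiv.Perm X) (K : ℕ)
    (hK : 3 * K < h.support.card) :
    ∃ A : Finset X, A.card = K ∧ A ⊆ h.support ∧ ∀ a ∈ A, h a ∉ A := by
  induction K with
  | zero => exact ⟨∅, by simp⟩
  | succ K ih =>
    obtain ⟨A, hA, hAs, hAh⟩ := ih (by omega)
    have hU : (A ∪ (A.image h ∪ A.image h.symm)).card ≤ 3 * K := by
      refine (Finset.card_union_le _ _).trans ?_
      have h1 := Finset.card_union_le (A.image h) (A.image h.symm)
      have h2 := Finset.card_image_le (s := A) (f := h)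
      have h3 := Finset.card_image_le (s := A) (f := h.symm)
      omega
    obtain ⟨y, hy, hyU⟩ := Finset.exists_mem_notMem_of_card_lt_card
      (s := A ∪ (A.image h ∪ A.image h.symm)) (t := h.support) (by omega)
    simp only [Finset.mem_union, not_or, Finset.mem_image, not_exists, not_and] at hyU
    obtain ⟨y1, y2, y3⟩ := hyU
    refine ⟨insert y A, ?_, ?_, ?_⟩
    · rw [Finset.card_insert_of_notMem y1, hA]
    · exact Finset.insert_subset hy hAs
    · intro a ha
      rw [Finset.mem_insert, not_or]
      rcases Finset.mem_insert.1 ha with rfl | ha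
      · exact ⟨Equiv.Perm.mem_support.1 hy, fun h5 => y3 _ h5 (by simp)⟩
      · exact ⟨y2 a ha, hAh a ha⟩

theorem costF_even (hC : 0 < WC) (hT : 0 < WT) (hn : 32 ≤ n) (k r B : ℕ) (hk : 1 ≤ k)
    (hBr : 2 ^ (k + 1) ≤ B * r) (hBn : 2 * (B * 2 ^ r) ≤ n)
    (h : Equiv.Perm (Fin n → Bool)) (hs : Equiv.Perm.sign h = 1) :
    CostF WC WT h (h.support.card / 2 ^ k * groupCost WC WT n k r B +
      (3 * 2 ^ k) * (2 * groupCost WC WT n 1 4 1)) := by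
  induction hm : h.support.card using Nat.strong_induction_on generalizing h with
  | _ m ih =>
    have hG := groupCost_nonneg (n := n) hC hT 1 4 1
    have hG' := groupCost_nonneg (n := n) hC hT k r B
    by_cases hlt : 3 * 2 ^ k < h.support.card
    · obtain ⟨A, hA, hAs, hAh⟩ := exists_independent h (2 ^ k) hlt
      obtain ⟨e⟩ : Nonempty ((Fin k → Bool) ≃ ↥A) := by
        rw [← Fintype.card_eq]; simp [hA]
      let x : (Fin k → Bool) × Bool → (Fin n → Bool) := fun ib =>
        if ib.2 then h (e ib.1).1 else (e ib.1).1
      have hx : Function.Injective x := by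
        rintro ⟨i, s⟩ ⟨i', s'⟩ heq
        simp only [x] at heq
        cases s <;> cases s'
        · simp only [Bool.false_eq_true, if_false] at heq
          rw [e.injective (Subtype.ext heq)]
        · simp only [Bool.false_eq_true, if_false, if_true] at heq
          exact absurd (heq ▸ (e i).2) (hAh _ (e i').2)
        · simp only [Bool.false_eq_true, if_false, if_true] at heq
          exact absurd (heq ▸ (e i').2) (hAh _ (e i).2)
        · simp only [if_true] at heq
          rw [e.injective (Subtype.ext (h.injective heq))]
      obtain ⟨p, hp, hp', hp1, hp2⟩ := exists_group (WC := WC) (WT := WT) hC hT k r B hk x hx hBr hBn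
      have hsign : Equiv.Perm.sign (p * h) = 1 := by
        rw [map_mul, hp.sign (by omega), hs, one_mul]
      have hsub : (p * h).support ⊆ h.support \ A := by
        intro z hz
        rw [Equiv.Perm.mem_support, Equiv.Perm.mul_apply] at hz
        have hzA : z ∉ A := by
          intro hzA
          apply hz
          have := hp1 (e.symm ⟨z, hzA⟩) true
          simpa [x] using this
        rw [Finset.mem_sdiff]
        refine ⟨?_, hzA⟩
        rw [Equiv.Perm.mem_support]
        intro hfix
        apply hz
        rw [hfix]
        apply hp2
        rintro ⟨⟨i, s⟩, hi⟩
        simp only [x] at hi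
        cases s
        · simp only [Bool.false_eq_true, if_false] at hi
          exact hzA (hi ▸ (e i).2)
        · simp only [if_true] at hi
          have : (e i).1 = z := h.injective (by rw [hi, hfix])
          exact hzA (this ▸ (e i).2)
      have hcard := Finset.card_le_card hsub
      rw [Finset.card_sdiff_of_subset hAs, hA] at hcard
      have hpos : 0 < 2 ^ k := by positivity
      have hrec := ih (p * h).support.card (by omega) (p * h) hsign rfl
      refine ((hp'.comp hrec).mono ?_).congr fun z => ?_
      · have h1 : ((p * h).support.card : ℝ) + 2 ^ k ≤ m := by
          have : (p * h).support.card + 2 ^ k ≤ m := by omega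
          exact_mod_cast this
        have h2 : ((p * h).support.card : ℝ) / 2 ^ k + 1 ≤ m / 2 ^ k := by
          rw [div_add_one (by positivity)]
          gcongr
        nlinarith
      · rw [Equiv.Perm.mul_apply, Equiv.symm_apply_apply]
    · refine (costF_rest hC hT hn h hs).mono ?_
      have h1 : (h.support.card : ℝ) ≤ 3 * 2 ^ k := by
        have : h.support.card ≤ 3 * 2 ^ k := by omega
        exact_mod_cast this
      have h2 : 0 ≤ (m : ℝ) / 2 ^ k * groupCost WC WT n k r B := by positivity
      nlinarith

theorem main_of_bound (hC : 0 < WC) (hT : 0 < WT) (hn : 4 ≤ n) (b : ℝ)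
    (H : ∀ h : Equiv.Perm (Fin n → Bool), Equiv.Perm.sign h = 1 → CostF WC WT h b) (hb : 0 ≤ b) :
    (∀ h : Equiv.Perm (Fin n → Bool), h ∈ alternatingGroup (Fin n → Bool) →
        ∃ c : List (RevCirc.Gate n), RevCirc.realizes c h ∧ RevCirc.weight WC WT c ≤ b) ∧
      RevCirc.ShannonW WC WT n 0 ≤ b := by
  constructor
  · intro h hh
    exact H h (Equiv.Perm.mem_alternatingGroup.1 hh)
  · apply Real.sSup_le _ hb
    rintro w ⟨f, ⟨c, π, hc⟩, rfl⟩
    obtain ⟨c', h1, h2⟩ := H (circPerm (n := n) c) (sign_circPerm hn c)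
    refine le_trans (csInf_le ⟨0, ?_⟩ ⟨c', ⟨π, fun x i => ?_⟩, rfl⟩) h2
    · rintro _ ⟨c, -, rfl⟩
      exact weight_nonneg hC hT c
    · rw [← hc x i]
      exact congrFun (h1 _) _

end
end RevCirc
namespace RevCirc

set_option maxHeartbeats 4000000 in
theorem numeric_bound {WC WT : ℝ} (hC : 0 < WC) (hT : 0 < WT) (n l r k B : ℕ)
    (hl1 : 2 ^ l ≤ n) (hl : 11 ≤ l) (hlW : 36 * (WC + WT) ≤ l * WC)
    (hr : r = l / 2) (hK1 : l ^ 2 ≤ 2 ^ k) (hK2 : 2 ^ k ≤ 4 * l ^ 2) (hB : B = 2 ^ (k + 1) / r + 1)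
    (hE : 1248 * (WC + WT) * (2 * r + 2) ^ 3 ≤ WC * 2 ^ r) :
    2 * (B * 2 ^ r) ≤ n ∧ 2 ^ (k + 1) ≤ B * r ∧
    2 ^ n / 2 ^ k * groupCost WC WT n k r B +
      (3 * 2 ^ k) * (2 * groupCost WC WT n 1 4 1) ≤ 16 * WC * n * 2 ^ n / (l + 1) := by
  have hr5 : 5 ≤ r := by omega
  have hrl : 2 * r ≤ l := by omega
  have hlr : l ≤ 2 * r + 1 := by omega
  have hBr : 2 ^ (k + 1) ≤ B * r := by
    rw [hB]
    have := Nat.lt_div_mul_add (a := 2 ^ (k+1)) (b := r) (by omega)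
    rw [add_mul, one_mul]; omega
  -- real versions
  have hlR : (11 : ℝ) ≤ l := by exact_mod_cast hl
  have hlrR : (l : ℝ) ≤ 2 * r + 1 := by exact_mod_cast hlr
  have hK1R : (l : ℝ) ^ 2 ≤ 2 ^ k := by exact_mod_cast hK1
  have hK2R : (2 : ℝ) ^ k ≤ 4 * l ^ 2 := by exact_mod_cast hK2
  have hr5R : (5 : ℝ) ≤ r := by exact_mod_cast hr5
  set K : ℝ := 2 ^ k with hK
  have hKpos : 0 < K := by positivity
  have hBR : (B : ℝ) ≤ 2 * K / r + 1 := by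
    rw [hB]
    push_cast
    have := Nat.cast_div_le (α := ℝ) (m := 2 ^ (k+1)) (n := r)
    push_cast at this
    have e : (2 : ℝ) ^ (k+1) = 2 * K := by rw [hK, pow_succ]; ring
    rw [e] at this
    linarith
  set W := WC + WT with hW
  have hWpos : 0 < W := by positivity
  have hB9 : (B : ℝ) ≤ 9 * l ^ 2 := by
    have h1 : 2 * K / r ≤ 2 * K := by
      rw [div_le_iff₀ (by linarith)]; nlinarith
    nlinarith
  have hl3 : (l : ℝ) ^ 2 * (l + 1) ≤ (2 * r + 2) ^ 3 := by
    have h1 : (l : ℝ) + 1 ≤ 2 * r + 2 := by linarith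
    have h2 : (l : ℝ) ^ 2 ≤ (2 * r + 2) ^ 2 := by
      apply pow_le_pow_left₀ <;> linarith
    calc (l : ℝ) ^ 2 * (l + 1) ≤ (2 * r + 2) ^ 2 * (2 * r + 2) := by gcongr
      _ = _ := by ring
  have hE' : 1248 * W * ((l : ℝ) ^ 2 * (l + 1)) ≤ WC * 2 ^ r := by
    refine le_trans ?_ hE
    gcongr
  have hnR : (2 : ℝ) ^ r * 2 ^ r ≤ n := by
    have : 2 ^ r * 2 ^ r ≤ n := by
      rw [← pow_add]
      exact (Nat.pow_le_pow_right (by norm_num) (by omega)).trans hl1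
    exact_mod_cast this
  have h2r : (0 : ℝ) < 2 ^ r := by positivity
  have hnpos : (0 : ℝ) < n := lt_of_lt_of_le (by positivity) hnR
  have hE2 : 1248 * ((l : ℝ) ^ 2 * (l + 1)) ≤ 2 ^ r := by
    have h1 : WC * (1248 * ((l : ℝ) ^ 2 * (l + 1))) ≤ WC * 2 ^ r := by
      refine le_trans ?_ hE'
      have : WC ≤ W := by linarith
      have h0 : 0 ≤ (l : ℝ) ^ 2 * (l + 1) := by positivity
      nlinarith
    exact le_of_mul_le_mul_left h1 hC
  refine ⟨?_, hBr, ?_⟩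
  · have : (2 : ℝ) * (B * 2 ^ r) ≤ n := by
      refine le_trans ?_ hnR
      have : 2 * (B : ℝ) ≤ 2 ^ r := by nlinarith [sq_nonneg (l : ℝ)]
      nlinarith
    exact_mod_cast this
  have hn32 : (32 : ℝ) ≤ n := by
    have h1 : (2 : ℝ) ^ 5 ≤ 2 ^ r := pow_le_pow_right₀ (by norm_num) hr5
    nlinarith
  -- first part
  have hG : groupCost WC WT n k r B * (l + 1) ≤ 15 * WC * n * K := by
    have e : (2 : ℝ) ^ (k + 5) = 32 * K := by rw [hK, pow_add]; norm_num; ring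
    unfold groupCost
    rw [e, ← hW]
    -- CNOT part
    have p1 : (B : ℝ) * (l + 1) ≤ 6 * K := by
      have h1 : 2 * K / r * (l + 1) ≤ 5 * K := by
        rw [div_mul_eq_mul_div, div_le_iff₀ (by linarith)]
        have : 2 * ((l : ℝ) + 1) ≤ 5 * r := by linarith
        nlinarith
      have h2 : (l : ℝ) + 1 ≤ K := by nlinarith
      have h3 : (B : ℝ) * (l + 1) ≤ (2 * K / r + 1) * (l + 1) := by gcongr
      linarith
    have p2 : 18 * W * (l + 1) ≤ WC * K := by
      have h1 : 18 * W * (l + 1) ≤ 36 * W * l := by nlinarith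
      have h2 : 36 * W * l ≤ WC * l ^ 2 := by nlinarith
      have h3 : WC * l ^ 2 ≤ WC * K := by gcongr
      linarith
    have p3 : 32 * (B * 2 ^ r) * W * (l + 1) ≤ WC * n := by
      have h1 : 32 * (B : ℝ) * W * (l + 1) ≤ WC * 2 ^ r := by
        refine le_trans ?_ hE'
        have : 32 * (B : ℝ) * (W * (l + 1)) ≤ 32 * (9 * l ^ 2) * (W * (l + 1)) := by gcongr
        have h0 : 0 ≤ W * ((l : ℝ) ^ 2 * (l + 1)) := by positivity
        nlinarith
      calc 32 * (B * 2 ^ r) * W * (l + 1) = 32 * (B : ℝ) * W * (l + 1) * 2 ^ r := by ring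
        _ ≤ WC * 2 ^ r * 2 ^ r := by gcongr
        _ = WC * (2 ^ r * 2 ^ r) := by ring
        _ ≤ WC * n := by gcongr
    calc (2 * B * n * WC + 18 * n * W + 32 * K * (B * 2 ^ r) * W) * (l + 1)
        = 2 * n * WC * (B * (l + 1)) + n * (18 * W * (l + 1)) +
            K * (32 * (B * 2 ^ r) * W * (l + 1)) := by ring
      _ ≤ 2 * n * WC * (6 * K) + n * (WC * K) + K * (WC * n) := by gcongr
      _ ≤ 15 * WC * n * K := by
        have : 0 ≤ WC * n * K := by positivity
        nlinarith
  have hG2 : groupCost WC WT n 1 4 1 ≤ 52 * n * W := by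
    unfold groupCost
    rw [← hW]
    norm_num
    have h1 : (n : ℝ) * WC ≤ n * W := by gcongr; linarith
    nlinarith
  have hrn : (2 : ℝ) ^ r ≤ 2 ^ n := by
    apply pow_le_pow_right₀ (by norm_num)
    have : l < 2 ^ l := Nat.lt_two_pow_self
    omega
  have hR : (3 * K) * (2 * groupCost WC WT n 1 4 1) * (l + 1) ≤ WC * n * 2 ^ n := by
    calc (3 * K) * (2 * groupCost WC WT n 1 4 1) * (l + 1)
        ≤ (3 * (4 * l ^ 2)) * (2 * (52 * n * W)) * (l + 1) := by
          have := groupCost_nonneg (n := n) hC hT 1 4 1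
          gcongr
      _ = n * (1248 * W * ((l : ℝ) ^ 2 * (l + 1))) := by ring
      _ ≤ n * (WC * 2 ^ r) := by gcongr
      _ ≤ n * (WC * 2 ^ n) := by gcongr
      _ = WC * n * 2 ^ n := by ring
  rw [le_div_iff₀ (by positivity), add_mul]
  have hfirst : 2 ^ n / K * groupCost WC WT n k r B * (l + 1) ≤ 15 * WC * n * 2 ^ n := by
    calc 2 ^ n / K * groupCost WC WT n k r B * (l + 1)
        = 2 ^ n / K * (groupCost WC WT n k r B * (l + 1)) := by ring
      _ ≤ 2 ^ n / K * (15 * WC * n * K) := by gcongr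
      _ = 15 * WC * n * 2 ^ n := by field_simp
  linarith

end RevCirc

/-- Theorem: every even permutation of `ℤ₂ⁿ` is realized by a circuit without additional
inputs of quantum weight at most `(16·W_C + 32·W_T + δ)·n·2ⁿ/log₂ n`; in particular
`W(n,0) ≤ (16·W_C + 32·W_T + δ)·n·2ⁿ/log₂ n`. -/
theorem shannonW_upper_bound_no_memory (WC WT : ℝ) (hWC : 0 < WC) (hWT : 0 < WT) :
    ∀ δ : ℝ, 0 < δ → ∃ n₀ : ℕ, ∀ n : ℕ, n > n₀ →
      (∀ h : Equiv.Perm (Fin n → Bool), h ∈ alternatingGroup (Fin n → Bool) →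
        ∃ c : List (RevCirc.Gate n), RevCirc.realizes c h ∧
          RevCirc.weight WC WT c ≤ (16 * WC + 32 * WT + δ) * n * 2 ^ n / Real.logb 2 n) ∧
      RevCirc.ShannonW WC WT n 0 ≤ (16 * WC + 32 * WT + δ) * n * 2 ^ n / Real.logb 2 n := by
  intro δ hδ
  have hW : 0 < WC + WT := by linarith
  have hlim := tendsto_pow_const_div_const_pow_of_one_lt 3 (one_lt_two : (1 : ℝ) < 2)
  have hev := hlim.eventually (gt_mem_nhds (show (0 : ℝ) < WC / (1248 * 64 * (WC + WT)) by positivity))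
  obtain ⟨r0, hr0⟩ := Filter.eventually_atTop.1 hev
  obtain ⟨l1, hl1⟩ := exists_nat_ge (36 * (WC + WT) / WC)
  refine ⟨2 ^ (11 + 2 * r0 + l1), fun n hn => ?_⟩
  set l := Nat.log 2 n with hl
  have hn0 : n ≠ 0 := by
    have : 0 < 2 ^ (11 + 2 * r0 + l1) := by positivity
    omega
  have hln : 2 ^ l ≤ n := Nat.pow_log_le_self 2 hn0
  have hnl : n < 2 ^ (l + 1) := Nat.lt_pow_succ_log_self (by norm_num) n
  have hlge : 11 + 2 * r0 + l1 ≤ l := by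
    have : 2 ^ (11 + 2 * r0 + l1) < 2 ^ (l + 1) := hn.trans hnl
    have := (Nat.pow_lt_pow_iff_right (by norm_num : 1 < 2)).1 this
    omega
  set m := Nat.log 2 l with hm
  have hml : 2 ^ m ≤ l := Nat.pow_log_le_self 2 (by omega)
  have hlm : l < 2 ^ (m + 1) := Nat.lt_pow_succ_log_self (by norm_num) l
  have hkk : 2 ^ (2 * (m + 1)) = (2 ^ (m + 1)) ^ 2 := by rw [← pow_mul]; ring_nf
  have hK1 : l ^ 2 ≤ 2 ^ (2 * (m + 1)) := by
    rw [hkk]; exact Nat.pow_le_pow_left hlm.le 2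
  have hK2 : 2 ^ (2 * (m + 1)) ≤ 4 * l ^ 2 := by
    have hsq := Nat.pow_le_pow_left hml 2
    rw [hkk, pow_succ 2 m, mul_pow]
    omega
  have hE : 1248 * (WC + WT) * (2 * ((l / 2 : ℕ) : ℝ) + 2) ^ 3 ≤ WC * 2 ^ (l / 2) := by
    have h1 := hr0 (l / 2) (by omega)
    have h5 : 1 ≤ l / 2 := by omega
    generalize l / 2 = r at h1 h5
    have h5R : (1 : ℝ) ≤ r := by exact_mod_cast h5
    rw [div_lt_div_iff₀ (by positivity) (by positivity)] at h1
    have h2 : (2 * (r : ℝ) + 2) ^ 3 ≤ (4 * r) ^ 3 := by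
      apply pow_le_pow_left₀ <;> linarith
    calc 1248 * (WC + WT) * (2 * (r : ℝ) + 2) ^ 3 ≤ 1248 * (WC + WT) * (4 * r) ^ 3 := by gcongr
      _ = (r : ℝ) ^ 3 * (1248 * 64 * (WC + WT)) := by ring
      _ ≤ WC * 2 ^ r := h1.le
  have hlW : 36 * (WC + WT) ≤ l * WC := by
    rw [← div_le_iff₀ hWC]
    refine hl1.trans ?_
    exact_mod_cast (by omega : l1 ≤ l)
  obtain ⟨hb1, hb2, hb3⟩ := RevCirc.numeric_bound hWC hWT n l (l / 2) (2 * (m + 1))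
    (2 ^ (2 * (m + 1) + 1) / (l / 2) + 1) hln (by omega) hlW rfl hK1 hK2 rfl hE
  have hn32 : 32 ≤ n := by
    have : 2 ^ 5 ≤ 2 ^ l := Nat.pow_le_pow_right (by norm_num) (by omega)
    omega
  have hlog0 : 0 < Real.logb 2 n := Real.logb_pos (by norm_num) (by exact_mod_cast (by omega : 1 < n))
  have hlog : Real.logb 2 n ≤ l + 1 := by
    rw [Real.logb_le_iff_le_rpow (by norm_num) (by positivity)]
    have : (n : ℝ) ≤ 2 ^ (l + 1) := by exact_mod_cast hnl.le
    exact_mod_cast this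
  have hfin : 16 * WC * n * 2 ^ n / (l + 1) ≤
      (16 * WC + 32 * WT + δ) * n * 2 ^ n / Real.logb 2 n := by
    gcongr
    linarith
  apply RevCirc.main_of_bound hWC hWT (by omega)
  · intro h hs
    refine (RevCirc.costF_even hWC hWT hn32 (2 * (m + 1)) (l / 2) _ (by omega) hb2 hb1 h hs).mono ?_
    refine le_trans ?_ (hb3.trans hfin)
    have hG := RevCirc.groupCost_nonneg (n := n) hWC hWT (2 * (m + 1)) (l / 2)
      (2 ^ (2 * (m + 1) + 1) / (l / 2) + 1)
    have hsupp : (h.support.card : ℝ) ≤ 2 ^ n := by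
      have := Finset.card_le_univ h.support
      rw [Fintype.card_fun, Fintype.card_bool, Fintype.card_fin] at this
      exact_mod_cast this
    gcongr
  · positivity
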